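/- arXiv:math/0201166 — 6 statements merged into one kernel-verified Lean document; each statement's English description precedes it below -/
import Mathlib

section
/- Let n ≥ 3 be an integer and let ε ∈ (0,1). Then there exists a twice continuously differentiable function u : ℝ → ℝ with u(0) = ε, u'(0) = 0, satisfying the Delaunay ODE u'' − ((n−2)²/4)·u + (n(n−2)/4)·u^((n+2)/(n−2)) = 0 on all of ℝ, and moreover 0 < u(t) < 1 for every t ∈ ℝ. -/
open Set Filter Topology intervalIntegral
open scoped NNReal

/-- A bounded Lipschitz autonomous vector field on a Banach space has a global integral curve
through every point. -/
theorem exists_global_integral_curve_of_lipschitz_of_bounded {E : Type*} [NormedAddCommGroup E]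
    [NormedSpace ℝ E] [CompleteSpace E] {f : E → E} {K L : ℝ≥0} (hf : LipschitzWith K f)
    (hL : ∀ x, ‖f x‖ ≤ L) (x₀ : E) :
    ∃ γ : ℝ → E, γ 0 = x₀ ∧ ∀ t, HasDerivAt γ (f (γ t)) t := by
  have local_curve (N : ℕ) : ∃ α : ℝ → E, α 0 = x₀ ∧
      ∀ t ∈ Ioo (-(N : ℝ)) N, HasDerivAt α (f (α t)) t := by
    have h0 : (0 : ℝ) ∈ Icc (-(N : ℝ)) N := by simp
    have hPL : IsPicardLindelof (fun _ ↦ f) ⟨0, h0⟩ x₀ (L * N) 0 L K :=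
      .of_time_independent (fun x _ ↦ hL x) hf.lipschitzOnWith (by simp)
    obtain ⟨α, h1, h2⟩ := hPL.exists_eq_forall_mem_Icc_hasDerivWithinAt₀
    exact ⟨α, h1, fun t ht ↦ (h2 t (Ioo_subset_Icc_self ht)).hasDerivAt (Icc_mem_nhds ht.1 ht.2)⟩
  choose α hα0 hα using local_curve
  have agree {m N : ℕ} (hmN : m ≤ N) {t : ℝ} (ht : t ∈ Ioo (-(m : ℝ)) m) : α m t = α N t := by
    have hm : (m : ℝ) ≤ N := by exact_mod_cast hmN
    have hpos : (0 : ℝ) < m := by linarith [ht.1, ht.2]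
    exact ODE_solution_unique_of_mem_Ioo (v := fun _ ↦ f) (s := fun _ ↦ univ) (t₀ := 0)
      (fun _ _ ↦ hf.lipschitzOnWith) (by simpa using hpos)
      (fun s hs ↦ ⟨hα m s hs, trivial⟩)
      (fun s hs ↦ ⟨hα N s ⟨by linarith [hs.1], by linarith [hs.2]⟩, trivial⟩)
      ((hα0 m).trans (hα0 N).symm) ht
  have hmem (t : ℝ) : t ∈ Ioo (-((⌊|t|⌋₊ + 1 : ℕ) : ℝ)) (⌊|t|⌋₊ + 1 : ℕ) := by
    rw [mem_Ioo, ← abs_lt]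
    exact_mod_cast Nat.lt_floor_add_one |t|
  refine ⟨fun t ↦ α (⌊|t|⌋₊ + 1) t, hα0 _, fun t ↦ ?_⟩
  refine (hα _ t (hmem t)).congr_of_eventuallyEq ?_
  filter_upwards [isOpen_Ioo.mem_nhds (hmem t)] with s hs
  rcases le_total (⌊|s|⌋₊ + 1) (⌊|t|⌋₊ + 1) with h | h
  · exact agree h (hmem s)
  · exact (agree h hs).symm

/-- The truncation of a real number to the interval `[a, b]`. -/
def clamp (a b x : ℝ) : ℝ := max a (min b x)

theorem lipschitzWith_clamp (a b : ℝ) : LipschitzWith 1 (clamp a b) :=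
  (LipschitzWith.id.const_min b).const_max a

theorem clamp_mem {a b : ℝ} (hab : a ≤ b) (x : ℝ) : clamp a b x ∈ Icc a b :=
  ⟨le_max_left _ _, max_le hab (min_le_left _ _)⟩

theorem clamp_of_mem {a b x : ℝ} (hx : x ∈ Icc a b) : clamp a b x = x := by
  rw [clamp, min_eq_right hx.2, max_eq_right hx.1]

theorem clamp_of_le {a b x : ℝ} (hab : a ≤ b) (hx : x ≤ a) : clamp a b x = a := by
  rw [clamp, min_eq_right (hx.trans hab), max_eq_left hx]

theorem clamp_of_ge {a b x : ℝ} (hab : a ≤ b) (hx : b ≤ x) : clamp a b x = b := by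
  rw [clamp, min_eq_left hx, max_eq_right hab]

theorem integral_clamp_nonneg {M : ℝ} (hM : 0 ≤ M) (v : ℝ) :
    0 ≤ ∫ s in (0 : ℝ)..v, clamp (-M) M s := by
  rcases le_total 0 v with hv | hv
  · refine integral_nonneg hv fun s hs ↦ ?_
    exact le_max_of_le_right (le_min hM hs.1)
  · rw [integral_symm, ← integral_neg]
    refine integral_nonneg hv fun s hs ↦ ?_
    rw [neg_nonneg]
    exact max_le (by linarith) ((min_le_right _ _).trans hs.2)

theorem half_sq_le_integral_clamp {M v : ℝ} (hM : 0 ≤ M) (hv : M ≤ |v|) :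
    M ^ 2 / 2 ≤ ∫ s in (0 : ℝ)..v, clamp (-M) M s := by
  have hc : Continuous (clamp (-M) M) := (lipschitzWith_clamp _ _).continuous
  have hi (a b : ℝ) : IntervalIntegrable (clamp (-M) M) MeasureTheory.volume a b :=
    hc.intervalIntegrable a b
  rcases le_total 0 v with h | h
  · rw [abs_of_nonneg h] at hv
    rw [← integral_add_adjacent_intervals (hi 0 M) (hi M v)]
    have h1 : ∫ s in (0 : ℝ)..M, clamp (-M) M s = M ^ 2 / 2 := by
      rw [integral_congr (g := fun s ↦ s)]
      · simp
      · intro s hs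
        rw [uIcc_of_le hM] at hs
        exact clamp_of_mem ⟨by linarith [hs.1], hs.2⟩
    have h2 : 0 ≤ ∫ s in M..v, clamp (-M) M s :=
      integral_nonneg hv fun s hs ↦ by rw [clamp_of_ge (by linarith) hs.1]; exact hM
    linarith
  · rw [abs_of_nonpos h] at hv
    rw [← integral_add_adjacent_intervals (hi 0 (-M)) (hi (-M) v)]
    have h1 : ∫ s in (0 : ℝ)..(-M), clamp (-M) M s = M ^ 2 / 2 := by
      rw [integral_congr (g := fun s ↦ s)]
      · simp
      · intro s hs
        rw [uIcc_of_ge (by linarith)] at hs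
        exact clamp_of_mem ⟨hs.1, by linarith [hs.2]⟩
    have h2 : 0 ≤ ∫ s in (-M)..v, clamp (-M) M s := by
      rw [integral_symm, ← integral_neg]
      exact integral_nonneg (by linarith) fun s hs ↦ by
        rw [clamp_of_le (by linarith) hs.2]; linarith
    linarith

/-- A Newtonian particle starting at rest at a point of `(0, 1)` where the force potential
`∫ G` is positive never leaves `(0, 1)` if that potential vanishes at both ends. -/
theorem exists_newton_trajectory_mem_Ioo {G : ℝ → ℝ} {K : ℝ≥0} {ε : ℝ}
    (hG : LipschitzOnWith K G (Icc 0 1)) (hG0 : G 0 = 0) (hG1 : G 1 ≤ 0)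
    (hint : ∫ s in (0 : ℝ)..1, G s = 0) (hε : ε ∈ Icc (0 : ℝ) 1)
    (hεpos : 0 < ∫ s in (0 : ℝ)..ε, G s) :
    ∃ u v : ℝ → ℝ, u 0 = ε ∧ v 0 = 0 ∧ (∀ t, HasDerivAt u (v t) t) ∧
      (∀ t, HasDerivAt v (G (u t)) t) ∧ ∀ t, u t ∈ Ioo (0 : ℝ) 1 := by
  have h01 : (0 : ℝ) ≤ 1 := zero_le_one
  set M : ℝ≥0 := 2 * K + 1 with hM
  have hMK : (K : ℝ) < (M : ℝ) ^ 2 / 2 := by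
    rw [hM]; push_cast; nlinarith [K.coe_nonneg]
  have hM0 : (0 : ℝ) ≤ M := M.coe_nonneg
  set F : ℝ → ℝ := fun x ↦ G (clamp 0 1 x) with hF
  have hFlip : LipschitzWith K F := by
    have := hG.comp (lipschitzWith_clamp 0 1).lipschitzOnWith
      (fun x (_ : x ∈ univ) ↦ clamp_mem h01 x)
    simpa [lipschitzOnWith_univ] using! this
  have hFG {x : ℝ} (hx : x ∈ Icc (0 : ℝ) 1) : F x = G x := by rw [hF]; simp only [clamp_of_mem hx]
  have hFle (x : ℝ) : |F x| ≤ K := by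
    have hw := clamp_mem h01 x
    have := hG.dist_le_mul _ hw 0 ⟨le_rfl, h01⟩
    rw [hG0, Real.dist_eq, Real.dist_eq, sub_zero, sub_zero, abs_of_nonneg hw.1] at this
    exact this.trans (mul_le_of_le_one_right K.coe_nonneg hw.2)
  have hclip : LipschitzWith 1 (clamp (-M) M) := lipschitzWith_clamp _ _
  have hclamp_le (x : ℝ) : |clamp (-M) M x| ≤ M := abs_le.2 (clamp_mem (by linarith) x)
  obtain ⟨γ, hγ0, hγ⟩ := exists_global_integral_curve_of_lipschitz_of_bounded
    (f := fun p : ℝ × ℝ ↦ (clamp (-M) M p.2, F p.1)) (L := M)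
    ((hclip.comp LipschitzWith.prod_snd).prodMk (hFlip.comp LipschitzWith.prod_fst))
    (fun p ↦ by
      refine max_le (hclamp_le _) ((hFle _).trans ?_)
      rw [hM]; push_cast; linarith [K.coe_nonneg])
    (ε, 0)
  have hu (t : ℝ) : HasDerivAt (fun t ↦ (γ t).1) (clamp (-M) M (γ t).2) t := (hγ t).fst
  have hv (t : ℝ) : HasDerivAt (fun t ↦ (γ t).2) (F (γ t).1) t := (hγ t).snd
  set P : ℝ → ℝ := fun x ↦ ∫ s in (0 : ℝ)..x, F s with hP
  set T : ℝ → ℝ := fun x ↦ ∫ s in (0 : ℝ)..x, clamp (-M) M s with hT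
  have hPd (x : ℝ) : HasDerivAt P (F x) x :=
    (hFlip.continuous.integral_hasStrictDerivAt 0 x).hasDerivAt
  have hTd (x : ℝ) : HasDerivAt T (clamp (-M) M x) x :=
    (hclip.continuous.integral_hasStrictDerivAt 0 x).hasDerivAt
  have hHd (t : ℝ) : HasDerivAt (fun t ↦ T (γ t).2 - P (γ t).1) 0 t := by
    convert! ((hTd _).comp t (hv t)).sub ((hPd _).comp t (hu t)) using 1
    ring
  have hPG {x : ℝ} (hx : x ∈ Icc (0 : ℝ) 1) : P x = ∫ s in (0 : ℝ)..x, G s :=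
    integral_congr fun s hs ↦ by
      rw [uIcc_of_le hx.1] at hs
      exact hFG ⟨hs.1, hs.2.trans hx.2⟩
  have energy (t : ℝ) : T (γ t).2 - P (γ t).1 = -P ε := by
    rw [is_const_of_deriv_eq_zero (fun t ↦ (hHd t).differentiableAt) (fun t ↦ (hHd t).deriv) t 0,
      hγ0]
    simp [hT]
  have hPε : 0 < P ε := by rwa [hPG hε]
  have hPpos (t : ℝ) : 0 < P (γ t).1 := by
    have h : 0 ≤ T (γ t).2 := integral_clamp_nonneg hM0 _
    linarith [energy t]
  have hmem (t : ℝ) : (γ t).1 ∈ Ioo (0 : ℝ) 1 := by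
    constructor
    · by_contra! h
      refine (hPpos t).ne' ?_
      rw [hP]
      refine (integral_congr (g := fun _ ↦ 0) fun s hs ↦ ?_).trans (by simp)
      rw [uIcc_of_ge h] at hs
      simp only [hF, clamp_of_le h01 hs.2, hG0]
    · by_contra! h
      refine (hPpos t).not_ge ?_
      have hi (a b : ℝ) : IntervalIntegrable F MeasureTheory.volume a b :=
        hFlip.continuous.intervalIntegrable a b
      have h1 : P 1 = 0 := by rw [hPG ⟨h01, le_rfl⟩, hint]
      have h2 : ∫ s in (1 : ℝ)..(γ t).1, F s ≤ 0 := by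
        rw [← neg_nonneg, ← integral_neg]
        refine integral_nonneg h fun s hs ↦ ?_
        simp only [hF, clamp_of_ge h01 hs.1]
        linarith
      have h3 : P (γ t).1 = P 1 + ∫ s in (1 : ℝ)..(γ t).1, F s :=
        (integral_add_adjacent_intervals (hi _ _) (hi _ _)).symm
      linarith
  have hPle (t : ℝ) : P (γ t).1 ≤ K := by
    have h : ‖∫ s in (0 : ℝ)..(γ t).1, F s‖ ≤ K * |(γ t).1 - 0| :=
      norm_integral_le_of_norm_le_const fun s _ ↦ hFle s
    rw [sub_zero, abs_of_pos (hmem t).1] at h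
    exact (le_abs_self _).trans (h.trans (mul_le_of_le_one_right K.coe_nonneg (hmem t).2.le))
  have hvle (t : ℝ) : |(γ t).2| ≤ M := by
    by_contra! h
    have : (M : ℝ) ^ 2 / 2 ≤ T (γ t).2 := half_sq_le_integral_clamp hM0 h.le
    linarith [energy t, hPle t]
  refine ⟨fun t ↦ (γ t).1, fun t ↦ (γ t).2, by simp [hγ0], by simp [hγ0], fun t ↦ ?_, fun t ↦ ?_,
    hmem⟩
  · simpa only [clamp_of_mem (abs_le.1 (hvle t))] using! hu t
  · simpa only [hFG (Ioo_subset_Icc_self (hmem t))] using! hv t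

theorem lipschitzOnWith_mul_sub_mul_rpow {a b p : ℝ} (hp : 1 ≤ p) :
    ∃ K : ℝ≥0, LipschitzOnWith K (fun x : ℝ ↦ a * x - b * x ^ p) (Icc 0 1) := by
  refine ⟨‖a‖₊ + ‖b‖₊ * ‖p‖₊, (convex_Icc 0 1).lipschitzOnWith_of_nnnorm_hasDerivWithin_le
    (f' := fun x ↦ a * 1 - b * (p * x ^ (p - 1))) (fun x _ ↦ ?_) fun x hx ↦ ?_⟩
  · exact (((hasDerivAt_id x).const_mul a).sub
      ((Real.hasDerivAt_rpow_const (Or.inr hp)).const_mul b)).hasDerivWithinAt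
  · refine (nnnorm_sub_le _ _).trans ?_
    rw [mul_one, nnnorm_mul, nnnorm_mul]
    have h : ‖x ^ (p - 1)‖₊ ≤ 1 := by
      rw [← NNReal.coe_le_coe, coe_nnnorm, Real.norm_of_nonneg (Real.rpow_nonneg hx.1 _)]
      exact Real.rpow_le_one hx.1 hx.2 (by linarith)
    gcongr
    exact mul_le_of_le_one_right' h

theorem integral_mul_sub_mul_rpow {a b p : ℝ} (hp : 0 ≤ p) (x : ℝ) :
    ∫ s in (0 : ℝ)..x, (a * s - b * s ^ p) = a * (x ^ 2 / 2) - b * (x ^ (p + 1) / (p + 1)) := by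
  rw [integral_sub (intervalIntegrable_id.const_mul a)
      ((intervalIntegrable_rpow (Or.inl hp)).const_mul b),
    integral_const_mul, integral_const_mul, integral_id, integral_rpow (Or.inl (by linarith)),
    Real.zero_rpow (by linarith)]
  ring

/-- Existence of a global Delaunay solution with necksize `ε ∈ (0,1)`, taking values in `(0,1)`. -/
theorem delaunay_solution_exists (n : ℕ) (hn : 3 ≤ n) (ε : ℝ) (hε0 : 0 < ε) (hε1 : ε < 1) :
    ∃ u : ℝ → ℝ, ContDiff ℝ 2 u ∧ u 0 = ε ∧ deriv u 0 = 0 ∧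
      (∀ t : ℝ,
        deriv (deriv u) t - ((n : ℝ) - 2) ^ 2 / 4 * u t
          + (n : ℝ) * ((n : ℝ) - 2) / 4 * (u t) ^ (((n : ℝ) + 2) / ((n : ℝ) - 2)) = 0) ∧
      (∀ t : ℝ, 0 < u t ∧ u t < 1) := by
  have hn3 : (3 : ℝ) ≤ n := by exact_mod_cast hn
  have hn2 : (0 : ℝ) < (n : ℝ) - 2 := by linarith
  set p : ℝ := ((n : ℝ) + 2) / ((n : ℝ) - 2) with hp
  have hp1 : 1 < p := by rw [hp, one_lt_div hn2]; linarith
  set a : ℝ := ((n : ℝ) - 2) ^ 2 / 4 with ha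
  set b : ℝ := (n : ℝ) * ((n : ℝ) - 2) / 4 with hb
  have ha0 : 0 < a := by positivity
  have hab : a ≤ b := by rw [ha, hb]; nlinarith
  have hbp : b = a * (p + 1) / 2 := by
    rw [ha, hb, hp]; field_simp; ring
  have hpot (x : ℝ) : ∫ s in (0 : ℝ)..x, (a * s - b * s ^ p) =
      a / 2 * (x ^ 2 - x ^ (p + 1)) := by
    rw [integral_mul_sub_mul_rpow (by linarith), hbp]
    field_simp
  obtain ⟨K, hK⟩ := lipschitzOnWith_mul_sub_mul_rpow (a := a) (b := b) hp1.le
  obtain ⟨u, v, hu0, hv0, hu, hv, hmem⟩ := exists_newton_trajectory_mem_Ioo (ε := ε) hK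
    (by simp [Real.zero_rpow (by linarith : p ≠ 0)]) (by simpa using hab) (by rw [hpot]; simp)
    ⟨hε0.le, hε1.le⟩ (by
      rw [hpot]
      have : ε ^ (p + 1) < ε ^ (2 : ℝ) := Real.rpow_lt_rpow_of_exponent_gt hε0 hε1 (by linarith)
      rw [Real.rpow_two] at this
      exact mul_pos (by linarith) (by linarith))
  have hdu : deriv u = v := funext fun t ↦ (hu t).deriv
  have hdv : deriv v = fun t ↦ a * u t - b * u t ^ p := funext fun t ↦ (hv t).deriv
  have hucont : Continuous u := Differentiable.continuous fun t ↦ (hu t).differentiableAt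
  refine ⟨u, ?_, hu0, by rw [hdu, hv0], fun t ↦ ?_, hmem⟩
  · rw [show (2 : WithTop ℕ∞) = 1 + 1 from one_add_one_eq_two.symm, contDiff_succ_iff_deriv, hdu,
      contDiff_one_iff_deriv, hdv]
    refine ⟨fun t ↦ (hu t).differentiableAt, by simp, fun t ↦ (hv t).differentiableAt, ?_⟩
    exact (hucont.const_mul a).sub
      ((hucont.rpow_const fun t ↦ Or.inl (hmem t).1.ne').const_mul b)
  · rw [hdu, hdv]
    ring
end

section
/- Let n ≥ 3 be an integer, let 0 < ε < ((n−2)/n)^((n−2)/4), and let u : ℝ → ℝ be a positive, twice differentiable solution of the Delaunay ODE u'' − ((n−2)²/4)·u + (n(n−2)/4)·u^((n+2)/(n−2)) = 0 with u(0) = ε and u'(0) = 0. Then ε ≤ u(t) < 1 for all t ∈ ℝ; that is, u attains its minimal value ε at t = 0 and is bounded above by 1. -/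
/-- The potential `x ^ 2 - x ^ (r + 2)` is strictly increasing up to its critical point. -/
theorem strictMonoOn_sq_sub_rpow {r c : ℝ} (hr : 0 < r) (hc : c ^ r ≤ 2 / (r + 2)) :
    StrictMonoOn (fun x : ℝ => x ^ 2 - x ^ (r + 2)) (Set.Icc 0 c) := by
  refine strictMonoOn_of_deriv_pos (convex_Icc 0 c) ?_ ?_
  · exact ((continuous_id.pow 2).sub
      (Real.continuous_rpow_const (by linarith))).continuousOn
  · intro x hx
    rw [interior_Icc] at hx
    obtain ⟨hx0, hxc⟩ := hx
    have hderiv : HasDerivAt (fun x : ℝ => x ^ 2 - x ^ (r + 2))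
        (2 * x - (r + 2) * x ^ (r + 2 - 1)) x := by
      refine ((hasDerivAt_pow 2 x).sub
        (Real.hasDerivAt_rpow_const (p := r + 2) (Or.inl hx0.ne'))).congr_deriv ?_
      norm_num
    rw [hderiv.deriv, show r + 2 - 1 = r + 1 by ring, Real.rpow_add_one hx0.ne']
    have hlt : x ^ r < 2 / (r + 2) := (Real.rpow_lt_rpow hx0.le hxc hr).trans_le hc
    rw [lt_div_iff₀ (by linarith)] at hlt
    nlinarith

/-- The energy of a positive solution of a Delaunay-type equation is constant in time. -/
theorem delaunay_energy_conserved {a r : ℝ} {u : ℝ → ℝ} (hu_pos : ∀ t, 0 < u t)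
    (hu1 : Differentiable ℝ u) (hu2 : Differentiable ℝ (deriv u))
    (hode : ∀ t, deriv (deriv u) t - a * u t + a * ((r + 2) / 2) * u t ^ (r + 1) = 0)
    (s t : ℝ) :
    deriv u s ^ 2 - a * (u s ^ 2 - u s ^ (r + 2))
      = deriv u t ^ 2 - a * (u t ^ 2 - u t ^ (r + 2)) := by
  have hderiv : ∀ x, HasDerivAt
      (fun t => deriv u t ^ 2 - a * (u t ^ 2 - u t ^ (r + 2))) 0 x := by
    intro x
    have hu := (hu1 x).hasDerivAt
    have h := ((hu2 x).hasDerivAt.pow 2).sub (((hu.pow 2).sub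
      (hu.rpow_const (p := r + 2) (Or.inl (hu_pos x).ne'))).const_mul a)
    refine h.congr_deriv ?_
    rw [show r + 2 - 1 = r + 1 by ring]
    push_cast
    linear_combination (2 * deriv u x) * hode x
  exact is_const_of_deriv_eq_zero (fun x => (hderiv x).differentiableAt)
    (fun x => (hderiv x).deriv) s t

/-- A Delaunay solution with necksize `ε` below the cylindrical value attains its minimum `ε`
at `t = 0` and is bounded above by `1`. -/
theorem delaunay_solution_bounds (n : ℕ) (hn : 3 ≤ n) (ε : ℝ) (hε0 : 0 < ε)
    (hεcyl : ε < (((n : ℝ) - 2) / (n : ℝ)) ^ (((n : ℝ) - 2) / 4))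
    (u : ℝ → ℝ) (hu_pos : ∀ t, 0 < u t)
    (hu1 : Differentiable ℝ u) (hu2 : Differentiable ℝ (deriv u))
    (hode : ∀ t : ℝ,
      deriv (deriv u) t - ((n : ℝ) - 2) ^ 2 / 4 * u t
        + (n : ℝ) * ((n : ℝ) - 2) / 4 * (u t) ^ (((n : ℝ) + 2) / ((n : ℝ) - 2)) = 0)
    (h0 : u 0 = ε) (h0' : deriv u 0 = 0) :
    ∀ t : ℝ, ε ≤ u t ∧ u t < 1 := by
  intro t
  have hn3 : (3 : ℝ) ≤ n := by exact_mod_cast hn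
  have hm : (0 : ℝ) < n - 2 := by linarith
  have hn0 : (0 : ℝ) < n := by linarith
  have hbase : (0 : ℝ) ≤ ((n : ℝ) - 2) / n := by positivity
  obtain ⟨r, hr⟩ : ∃ r : ℝ, r = 4 / ((n : ℝ) - 2) := ⟨_, rfl⟩
  have hr0 : 0 < r := by rw [hr]; positivity
  have hcrit : ((((n : ℝ) - 2) / n) ^ (((n : ℝ) - 2) / 4)) ^ r ≤ 2 / (r + 2) := by
    rw [← Real.rpow_mul hbase, hr,
      show ((n : ℝ) - 2) / 4 * (4 / ((n : ℝ) - 2)) = 1 by field_simp, Real.rpow_one]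
    apply le_of_eq
    rw [show 4 / ((n : ℝ) - 2) + 2 = 2 * n / (n - 2) by field_simp; ring]
    field_simp
  have hεone : ε < 1 := hεcyl.trans_le
    (Real.rpow_le_one hbase ((div_le_one hn0).2 (by linarith)) (by positivity))
  have henergy := delaunay_energy_conserved (a := ((n : ℝ) - 2) ^ 2 / 4) (r := r)
    hu_pos hu1 hu2 (fun x => by
      rw [← hode x, show ((n : ℝ) + 2) / (n - 2) = r + 1 by rw [hr]; field_simp; ring,
        show (n : ℝ) * (n - 2) / 4 = ((n : ℝ) - 2) ^ 2 / 4 * ((r + 2) / 2) by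
          rw [hr]; field_simp; ring]) t 0
  rw [h0, h0'] at henergy
  have hpotential : ε ^ 2 - ε ^ (r + 2) ≤ u t ^ 2 - u t ^ (r + 2) := by
    have ha : (0 : ℝ) < ((n : ℝ) - 2) ^ 2 / 4 := by positivity
    refine le_of_mul_le_mul_left ?_ ha
    nlinarith [sq_nonneg (deriv u t)]
  constructor
  · by_contra! hlt
    exact (strictMonoOn_sq_sub_rpow hr0 hcrit
      ⟨(hu_pos t).le, (hlt.trans hεcyl).le⟩ ⟨hε0.le, hεcyl.le⟩ hlt).not_ge hpotential
  · by_contra! hge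
    have hε : ε ^ (r + 2) < ε ^ (2 : ℝ) :=
      Real.rpow_lt_rpow_of_exponent_gt hε0 hεone (by linarith)
    have hu : u t ^ (2 : ℝ) ≤ u t ^ (r + 2) :=
      Real.rpow_le_rpow_of_exponent_le hge (by linarith)
    rw [Real.rpow_two] at hε hu
    linarith
end

section
/- Let n ≥ 3 be an integer, let ε ∈ (0,1), and let u : ℝ → ℝ be a positive, twice differentiable solution of the Delaunay ODE u'' − ((n−2)²/4)·u + (n(n−2)/4)·u^((n+2)/(n−2)) = 0 with u(0) = ε and u'(0) = 0. Then |u'(t)| ≤ ((n−2)/2)·u(t) for all t ∈ ℝ; in particular the logarithmic derivative of u is bounded in absolute value by (n−2)/2. -/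
/-- The Hamiltonian energy of the Delaunay ODE is constant along positive solutions. -/
theorem delaunay_energy_eq {d : ℝ} (hd : d - 2 ≠ 0) {u : ℝ → ℝ} (hu_pos : ∀ t, 0 < u t)
    (hu1 : Differentiable ℝ u) (hu2 : Differentiable ℝ (deriv u))
    (hode : ∀ t : ℝ, deriv (deriv u) t - (d - 2) ^ 2 / 4 * u t
      + d * (d - 2) / 4 * (u t) ^ ((d + 2) / (d - 2)) = 0) (s t : ℝ) :
    deriv u s ^ 2 - (d - 2) ^ 2 / 4 * u s ^ 2 + (d - 2) ^ 2 / 4 * u s ^ (2 * d / (d - 2)) =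
      deriv u t ^ 2 - (d - 2) ^ 2 / 4 * u t ^ 2 + (d - 2) ^ 2 / 4 * u t ^ (2 * d / (d - 2)) := by
  have hderiv (x : ℝ) : HasDerivAt (fun x ↦ deriv u x ^ 2 - (d - 2) ^ 2 / 4 * u x ^ 2
      + (d - 2) ^ 2 / 4 * u x ^ (2 * d / (d - 2))) 0 x := by
    have h1 := (hu1 x).hasDerivAt
    have h2 := (hu2 x).hasDerivAt
    have h := ((h2.pow 2).sub ((h1.pow 2).const_mul ((d - 2) ^ 2 / 4))).add
      ((h1.rpow_const (p := 2 * d / (d - 2)) (Or.inl (hu_pos x).ne')).const_mul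
        ((d - 2) ^ 2 / 4))
    refine h.congr_deriv ?_
    have hexp : 2 * d / (d - 2) - 1 = (d + 2) / (d - 2) := by
      field_simp
      ring
    have hcoef : (d - 2) ^ 2 / 4 * (2 * d / (d - 2)) = d * (d - 2) / 2 := by
      field_simp
      ring
    rw [hexp]
    push_cast
    linear_combination 2 * deriv u x * hode x +
      deriv u x * u x ^ ((d + 2) / (d - 2)) * hcoef
  exact is_const_of_deriv_eq_zero (fun x ↦ (hderiv x).differentiableAt)
    (fun x ↦ (hderiv x).deriv) s t

/-- The logarithmic derivative of a Delaunay solution with necksize `ε ∈ (0,1)` is bounded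
in absolute value by `(n-2)/2`. -/
theorem delaunay_log_deriv_bound (n : ℕ) (hn : 3 ≤ n) (ε : ℝ) (hε0 : 0 < ε) (hε1 : ε < 1)
    (u : ℝ → ℝ) (hu_pos : ∀ t, 0 < u t)
    (hu1 : Differentiable ℝ u) (hu2 : Differentiable ℝ (deriv u))
    (hode : ∀ t : ℝ,
      deriv (deriv u) t - ((n : ℝ) - 2) ^ 2 / 4 * u t
        + (n : ℝ) * ((n : ℝ) - 2) / 4 * (u t) ^ (((n : ℝ) + 2) / ((n : ℝ) - 2)) = 0)
    (h0 : u 0 = ε) (h0' : deriv u 0 = 0) :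
    ∀ t : ℝ, |deriv u t| ≤ ((n : ℝ) - 2) / 2 * u t := by
  intro t
  have hn3 : (3 : ℝ) ≤ n := by exact_mod_cast hn
  have hd : (0 : ℝ) < n - 2 := by linarith
  have henergy := delaunay_energy_eq hd.ne' hu_pos hu1 hu2 hode t 0
  rw [h0, h0'] at henergy
  have hneck : ε ^ (2 * (n : ℝ) / (n - 2)) ≤ ε ^ 2 := by
    rw [← Real.rpow_natCast ε 2]
    refine Real.rpow_le_rpow_of_exponent_ge hε0 hε1.le ?_
    rw [le_div_iff₀ hd]
    push_cast
    linarith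
  have hpot := mul_le_mul_of_nonneg_left hneck (by positivity : (0 : ℝ) ≤ ((n : ℝ) - 2) ^ 2 / 4)
  have hpow : 0 ≤ ((n : ℝ) - 2) ^ 2 / 4 * u t ^ (2 * (n : ℝ) / (n - 2)) :=
    mul_nonneg (by positivity) (Real.rpow_nonneg (hu_pos t).le _)
  refine abs_le_of_sq_le_sq ?_ (mul_nonneg (by linarith) (hu_pos t).le)
  linarith [mul_pow (((n : ℝ) - 2) / 2) (u t) 2, div_pow ((n : ℝ) - 2) 2 2]
end

section
/- Let n ≥ 3 be an integer, let 0 < ε < ((n−2)/n)^((n−2)/4), and let u : ℝ → ℝ be a positive, twice differentiable solution of the Delaunay ODE u'' − ((n−2)²/4)·u + (n(n−2)/4)·u^((n+2)/(n−2)) = 0 with u(0) = ε and u'(0) = 0. Then u is periodic: there exists T > 0 such that u(t + T) = u(t) for all t ∈ ℝ. -/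
open Set in
/-- A positive solution of the autonomous equation `u'' = f u`, with `f` of class `C¹` on the
positive half-line, is symmetric about each of its critical points. -/
theorem symm_about_critical_point {f u : ℝ → ℝ} (hf : ContDiffOn ℝ 1 f (Ioi 0))
    (hpos : ∀ t, 0 < u t) (hu : Differentiable ℝ u)
    (hode : ∀ t, HasDerivAt (deriv u) (f (u t)) t) {T : ℝ} (hT : deriv u T = 0) (s : ℝ) :
    u (T + s) = u (T - s) := by
  wlog hs : 0 ≤ s generalizing s
  · have := this (-s) (by linarith)
    rw [sub_neg_eq_add, ← sub_eq_add_neg] at this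
    exact this.symm
  obtain ⟨x, -, hx⟩ := (isCompact_Icc (a := T - s) (b := T + s)).exists_isMinOn
    ⟨T, by constructor <;> linarith⟩ hu.continuous.continuousOn
  obtain ⟨y, -, hy⟩ := (isCompact_Icc (a := T - s) (b := T + s)).exists_isMaxOn
    ⟨T, by constructor <;> linarith⟩ hu.continuous.continuousOn
  have hmem : ∀ t ∈ Icc (T - s) (T + s), u t ∈ Icc (u x) (u y) := fun t ht ↦ ⟨hx ht, hy ht⟩
  obtain ⟨K, hK⟩ := (hf.mono fun z (hz : z ∈ Icc (u x) (u y)) ↦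
    (hpos x).trans_le hz.1).exists_lipschitzOnWith one_ne_zero (convex_Icc _ _) isCompact_Icc
  have hlip : LipschitzOnWith (max 1 (K * 1)) (fun p : ℝ × ℝ ↦ (p.2, f p.1))
      (Icc (u x) (u y) ×ˢ univ) :=
    LipschitzWith.prod_snd.lipschitzOnWith.prodMk
      (hK.comp LipschitzWith.prod_fst.lipschitzOnWith fun p hp ↦ hp.1)
  have hright : ∀ t, HasDerivAt (fun t ↦ (u (T + t), deriv u (T + t)))
      (deriv u (T + t), f (u (T + t))) t := fun t ↦
    ((hu (T + t)).hasDerivAt.comp_const_add T t).prodMk ((hode (T + t)).comp_const_add T t)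
  have hleft : ∀ t, HasDerivAt (fun t ↦ (u (T - t), -deriv u (T - t)))
      (-deriv u (T - t), f (u (T - t))) t := fun t ↦ by
    simpa using ((hu (T - t)).hasDerivAt.comp_const_sub T t).prodMk
      ((hode (T - t)).comp_const_sub T t).neg
  have key := ODE_solution_unique_of_mem_Icc_right (a := 0) (b := s)
    (v := fun _ p ↦ (p.2, f p.1)) (s := fun _ ↦ Icc (u x) (u y) ×ˢ univ)
    (fun _ _ ↦ hlip)
    (fun t _ ↦ (hright t).continuousAt.continuousWithinAt)
    (fun t _ ↦ (hright t).hasDerivWithinAt)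
    (fun t ht ↦ ⟨hmem _ ⟨by linarith [ht.1], by linarith [ht.2]⟩, mem_univ _⟩)
    (fun t _ ↦ (hleft t).continuousAt.continuousWithinAt)
    (fun t _ ↦ (hleft t).hasDerivWithinAt)
    (fun t ht ↦ ⟨hmem _ ⟨by linarith [ht.2], by linarith [ht.1]⟩, mem_univ _⟩)
    (by simp [hT])
  exact congrArg Prod.fst (key (right_mem_Icc.2 hs))

open Set in
/-- If `f` is positive on `(0, c)` and bounded away from zero by a negative constant on every
`[d, ∞)` with `d > c`, then a positive solution of `u'' = f u` starting at rest below `c` has a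
further critical point at a positive time. -/
theorem exists_pos_critical_point {f u : ℝ → ℝ} {c : ℝ} (hfpos : ∀ x, 0 < x → x < c → 0 < f x)
    (hfneg : ∀ d, c < d → ∃ δ > 0, ∀ x, d ≤ x → f x ≤ -δ)
    (hpos : ∀ t, 0 < u t) (hu : Differentiable ℝ u)
    (hode : ∀ t, HasDerivAt (deriv u) (f (u t)) t) (h0 : u 0 < c) (h0' : deriv u 0 = 0) :
    ∃ T > 0, deriv u T = 0 := by
  by_contra! hne
  have hv : Differentiable ℝ (deriv u) := fun t ↦ (hode t).differentiableAt
  have hex : ∃ t > 0, 0 < deriv u t := by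
    by_contra! hnp
    have hanti : AntitoneOn u (Ici 0) :=
      antitoneOn_of_deriv_nonpos (convex_Ici 0) hu.continuous.continuousOn hu.differentiableOn
        fun t ht ↦ hnp t (by simpa using ht)
    have hmono : StrictMonoOn (deriv u) (Ici 0) :=
      strictMonoOn_of_deriv_pos (convex_Ici 0) hv.continuous.continuousOn fun t ht ↦ by
        rw [interior_Ici, mem_Ioi] at ht
        rw [(hode t).deriv]
        exact hfpos _ (hpos t) ((hanti self_mem_Ici ht.le ht.le).trans_lt h0)
    have h1 := hmono self_mem_Ici (mem_Ici.2 zero_le_one) zero_lt_one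
    linarith [hnp 1 one_pos]
  obtain ⟨t₀, ht₀, hvt₀⟩ := hex
  have hvpos : ∀ t > 0, 0 < deriv u t := by
    intro t ht
    by_contra! hle
    obtain ⟨T, hT, hT0⟩ := isPreconnected_Ioi.intermediate_value (mem_Ioi.2 ht) (mem_Ioi.2 ht₀)
      hv.continuous.continuousOn ⟨hle, hvt₀.le⟩
    exact hne T hT hT0
  have humono : StrictMonoOn u (Ici 0) :=
    strictMonoOn_of_deriv_pos (convex_Ici 0) hu.continuous.continuousOn fun t ht ↦
      hvpos t (by simpa using ht)
  have hcross : ∃ t > 0, c < u t := by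
    by_contra! hle
    have hlt : ∀ t > 0, u t < c := fun t ht ↦
      (humono (mem_Ici.2 ht.le) (mem_Ici.2 (by linarith)) (lt_add_one t)).trans_le
        (hle (t + 1) (by linarith))
    have hmono : StrictMonoOn (deriv u) (Ici 0) :=
      strictMonoOn_of_deriv_pos (convex_Ici 0) hv.continuous.continuousOn fun t ht ↦ by
        rw [interior_Ici, mem_Ioi] at ht
        rw [(hode t).deriv]
        exact hfpos _ (hpos t) (hlt t ht)
    have hlin := (convex_Ici (1 : ℝ)).mul_sub_le_image_sub_of_le_deriv
      hu.continuous.continuousOn hu.differentiableOn (C := deriv u 1) fun t ht ↦ by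
        rw [interior_Ici, mem_Ioi] at ht
        exact (hmono (mem_Ici.2 zero_le_one) (mem_Ici.2 (by linarith)) ht).le
    have h1 := hvpos 1 one_pos
    have hc : 0 < c := (hpos 0).trans h0
    have hR : 0 < c / deriv u 1 := by positivity
    have h2 := hlin 1 self_mem_Ici (1 + c / deriv u 1) (mem_Ici.2 (by linarith)) (by linarith)
    rw [add_sub_cancel_left, mul_div_cancel₀ _ h1.ne'] at h2
    linarith [hlt (1 + c / deriv u 1) (by linarith), hpos 1]
  obtain ⟨t₁, ht₁, hct₁⟩ := hcross
  obtain ⟨δ, hδ, hfδ⟩ := hfneg _ hct₁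
  have hlin := (convex_Ici t₁).image_sub_le_mul_sub_of_deriv_le
    hv.continuous.continuousOn hv.differentiableOn (C := -δ) fun t ht ↦ by
      rw [interior_Ici, mem_Ioi] at ht
      rw [(hode t).deriv]
      exact hfδ _ (humono (mem_Ici.2 ht₁.le) (mem_Ici.2 (by linarith)) ht).le
  have h1 := hvpos t₁ ht₁
  have hR : 0 < deriv u t₁ / δ := by positivity
  have h2 := hlin t₁ self_mem_Ici (t₁ + deriv u t₁ / δ) (mem_Ici.2 (by linarith)) (by linarith)
  rw [add_sub_cancel_left, neg_mul, mul_div_cancel₀ _ hδ.ne'] at h2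
  linarith [hvpos (t₁ + deriv u t₁ / δ) (by linarith)]


/-- A Delaunay solution with necksize below the cylindrical value is periodic. -/
theorem delaunay_solution_periodic (n : ℕ) (hn : 3 ≤ n) (ε : ℝ) (hε0 : 0 < ε)
    (hεcyl : ε < (((n : ℝ) - 2) / (n : ℝ)) ^ (((n : ℝ) - 2) / 4))
    (u : ℝ → ℝ) (hu_pos : ∀ t, 0 < u t)
    (hu1 : Differentiable ℝ u) (hu2 : Differentiable ℝ (deriv u))
    (hode : ∀ t : ℝ,
      deriv (deriv u) t - ((n : ℝ) - 2) ^ 2 / 4 * u t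
        + (n : ℝ) * ((n : ℝ) - 2) / 4 * (u t) ^ (((n : ℝ) + 2) / ((n : ℝ) - 2)) = 0)
    (h0 : u 0 = ε) (h0' : deriv u 0 = 0) :
    ∃ T > 0, ∀ t : ℝ, u (t + T) = u t := by
  have hn3 : (3 : ℝ) ≤ n := by exact_mod_cast hn
  have hm : (0 : ℝ) < n - 2 := by linarith
  have hn0 : (0 : ℝ) < n := by linarith
  have hq : (0 : ℝ) < 4 / (n - 2) := by positivity
  set c : ℝ := ((n - 2) / n) ^ (((n : ℝ) - 2) / 4) with hc
  have hc0 : 0 < c := by positivity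
  have hcq : c ^ (4 / ((n : ℝ) - 2)) = (n - 2) / n := by
    rw [hc, ← Real.rpow_mul (by positivity), div_mul_div_cancel₀ (by norm_num),
      div_self hm.ne', Real.rpow_one]
  set f : ℝ → ℝ := fun x ↦ ((n : ℝ) - 2) ^ 2 / 4 * x
    - n * ((n : ℝ) - 2) / 4 * x ^ (((n : ℝ) + 2) / ((n : ℝ) - 2)) with hf
  have hfactor : ∀ x, 0 < x → f x =
      x * (n * (n - 2) / 4 * (c ^ (4 / ((n : ℝ) - 2)) - x ^ (4 / ((n : ℝ) - 2)))) := by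
    intro x hx
    have hexp : ((n : ℝ) + 2) / (n - 2) = 4 / (n - 2) + 1 := by
      field_simp
      ring
    simp only [hf]
    rw [hcq, hexp, Real.rpow_add_one hx.ne']
    field_simp
  have hfC : ContDiffOn ℝ 1 f (Set.Ioi 0) := by
    refine (contDiffOn_const.mul contDiffOn_id).sub (contDiffOn_const.mul fun x hx ↦ ?_)
    exact (Real.contDiffAt_rpow_const_of_ne (ne_of_gt hx)).contDiffWithinAt
  have hode' : ∀ t, HasDerivAt (deriv u) (f (u t)) t := by
    intro t
    have h : deriv (deriv u) t = f (u t) := by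
      simp only [hf]
      linarith [hode t]
    exact h ▸ (hu2 t).hasDerivAt
  have hfpos : ∀ x, 0 < x → x < c → 0 < f x := by
    intro x hx hxc
    rw [hfactor x hx]
    have := sub_pos.2 (Real.rpow_lt_rpow hx.le hxc hq)
    positivity
  have hfneg : ∀ d, c < d → ∃ δ > 0, ∀ x, d ≤ x → f x ≤ -δ := by
    intro d hd
    have hd0 : 0 < d := hc0.trans hd
    have hgap := sub_pos.2 (Real.rpow_lt_rpow hc0.le hd hq)
    refine ⟨d * (n * (n - 2) / 4 * (d ^ (4 / ((n : ℝ) - 2)) - c ^ (4 / ((n : ℝ) - 2)))),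
      by positivity, fun x hx ↦ ?_⟩
    rw [hfactor x (hd0.trans_le hx), le_neg, ← mul_neg, ← mul_neg, neg_sub]
    gcongr
    exact (hd0.trans_le hx).le
  obtain ⟨T, hT, hT'⟩ := exists_pos_critical_point hfpos hfneg hu_pos hu1 hode'
    (h0.trans_lt hεcyl) h0'
  refine ⟨2 * T, by positivity, fun t ↦ ?_⟩
  have h1 := symm_about_critical_point hfC hu_pos hu1 hode' hT' (T + t)
  have h2 := symm_about_critical_point hfC hu_pos hu1 hode' h0' t
  rw [zero_add, zero_sub] at h2
  rw [h2, show t + 2 * T = T + (T + t) by ring, h1, sub_add_cancel_left]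
end

section
/- Let n ≥ 3 be an integer, let 0 < ε < ((n−2)/n)^((n−2)/4), and let u : ℝ → ℝ be a positive, twice differentiable solution of the Delaunay ODE u'' − ((n−2)²/4)·u + (n(n−2)/4)·u^((n+2)/(n−2)) = 0 with u(0) = ε and u'(0) = 0. Then the supremum ε̄ = sup_{t∈ℝ} u(t) is attained at some t₁ ∈ ℝ, satisfies ε < ε̄ < 1, and satisfies the energy relation ε̄² − ε̄^(2n/(n−2)) = ε² − ε^(2n/(n−2)). -/
open Set Filter Topology

/-- If a differentiable function and its derivative both converge at infinity, then the limit of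
the derivative is zero. -/
theorem tendsto_deriv_atTop_eq_zero {f : ℝ → ℝ} {L m : ℝ} (hf : Differentiable ℝ f)
    (hL : Tendsto f atTop (𝓝 L)) (hm : Tendsto (deriv f) atTop (𝓝 m)) : m = 0 := by
  have hmvt : ∀ t : ℝ, ∃ ξ, t < ξ ∧ deriv f ξ = f (t + 1) - f t := fun t => by
    obtain ⟨ξ, hξ, h⟩ := exists_deriv_eq_slope f (lt_add_one t) hf.continuous.continuousOn
      hf.differentiableOn
    exact ⟨ξ, hξ.1, by simpa using h⟩
  choose ξ hξ hslope using hmvt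
  have h₁ : Tendsto (fun t => deriv f (ξ t)) atTop (𝓝 m) :=
    hm.comp (tendsto_atTop_mono (fun t => (hξ t).le) tendsto_id)
  have h₂ : Tendsto (fun t => f (t + 1) - f t) atTop (𝓝 (L - L)) :=
    (hL.comp (tendsto_atTop_add_const_right _ 1 tendsto_id)).sub hL
  simp only [hslope] at h₁
  simpa using tendsto_nhds_unique h₁ h₂

/-- Conservation of energy for Newton's equation `u'' = V'(u)` on the half-line `u > 0`. -/
theorem sq_deriv_eq_of_deriv_deriv_eq {V V' u : ℝ → ℝ}
    (hV : ∀ x, 0 < x → HasDerivAt V (V' x) x) (hpos : ∀ t, 0 < u t)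
    (hu : Differentiable ℝ u) (hu' : Differentiable ℝ (deriv u))
    (hode : ∀ t, deriv (deriv u) t = V' (u t)) (h0 : deriv u 0 = 0) (t : ℝ) :
    deriv u t ^ 2 = 2 * (V (u t) - V (u 0)) := by
  have hE : ∀ s, HasDerivAt (fun s => deriv u s ^ 2 - 2 * V (u s)) 0 s := fun s => by
    have h₁ := (hu' s).hasDerivAt.pow 2
    have h₂ := ((hV _ (hpos s)).comp s (hu s).hasDerivAt).const_mul 2
    refine (h₁.sub h₂).congr_deriv ?_
    rw [hode]
    push_cast
    ring
  have h := is_const_of_deriv_eq_zero (fun s => (hE s).differentiableAt)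
    (fun s => (hE s).deriv) t 0
  simp only [h0] at h
  linarith

/-- A positive solution of `u'' = V'(u)` started at rest from the left of the maximum `a` of a
single-hump potential `V` reaches its maximum, which is the other point at the same level. -/
theorem exists_isGreatest_range_of_deriv_deriv_eq {V V' u : ℝ → ℝ} {a b : ℝ}
    (hV : ∀ x, 0 < x → HasDerivAt V (V' x) x) (hV' : ContinuousOn V' (Ioi 0))
    (hinc : ∀ x, 0 < x → x < a → 0 < V' x) (hdec : ∀ x, a < x → V' x < 0)
    (hpos : ∀ t, 0 < u t) (hu : Differentiable ℝ u) (hu' : Differentiable ℝ (deriv u))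
    (hode : ∀ t, deriv (deriv u) t = V' (u t)) (h0 : deriv u 0 = 0) (h0a : u 0 < a)
    (hab : a < b) (hVb : V b < V (u 0)) :
    ∃ M, IsGreatest (range u) M ∧ u 0 < M ∧ M < b ∧ V M = V (u 0) := by
  have ha : 0 < a := (hpos 0).trans h0a
  have henergy := sq_deriv_eq_of_deriv_deriv_eq hV hpos hu hu' hode h0
  have hmono : StrictMonoOn V (Ioc 0 a) := by
    refine strictMonoOn_of_deriv_pos (convex_Ioc 0 a)
      (fun x hx => (hV x hx.1).continuousAt.continuousWithinAt) fun x hx => ?_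
    rw [interior_Ioc] at hx
    rw [(hV x hx.1).deriv]
    exact hinc x hx.1 hx.2
  have hanti : StrictAntiOn V (Ici a) := by
    refine strictAntiOn_of_deriv_neg (convex_Ici a)
      (fun x hx => (hV x (ha.trans_le hx)).continuousAt.continuousWithinAt) fun x hx => ?_
    rw [interior_Ici] at hx
    rw [(hV x (ha.trans hx)).deriv]
    exact hdec x hx
  have hlevel : ∀ t, V (u 0) ≤ V (u t) := fun t => by
    nlinarith [henergy t, sq_nonneg (deriv u t)]
  have hlower : ∀ t, u 0 ≤ u t := fun t => by
    by_contra! h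
    exact (hlevel t).not_gt (hmono ⟨hpos t, (h.trans h0a).le⟩ ⟨hpos 0, h0a.le⟩ h)
  have hupper : ∀ t, u t < b := fun t => by
    by_contra! h
    exact ((hlevel t).trans (hanti.antitoneOn hab.le (hab.le.trans h) h)).not_gt hVb
  have hcross : ∀ x, u 0 < x → V x = V (u 0) → a < x := fun x hx hVx => by
    by_contra! h
    exact (hmono ⟨hpos 0, h0a.le⟩ ⟨(hpos 0).trans hx, h⟩ hx).ne' hVx
  obtain ⟨s, hs0, hs⟩ : ∃ s, 0 < s ∧ 0 < deriv u s := by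
    have hd : 0 < deriv (deriv u) 0 := by
      rw [hode]
      exact hinc _ (hpos 0) h0a
    have hev := eventually_nhdsWithin_sign_eq_of_deriv_pos hd h0
    obtain ⟨s, hs, hs0⟩ := ((hev.filter_mono nhdsWithin_le_nhds).and
      (self_mem_nhdsWithin : Ioi (0 : ℝ) ∈ 𝓝[>] 0)).exists
    have hs0 : 0 < s := hs0
    rw [sub_zero, sign_pos hs0, sign_eq_one_iff] at hs
    exact ⟨s, hs0, hs⟩
  have hus : u 0 < u s := by
    refine (hlower s).lt_of_ne fun h => ?_
    have := henergy s
    rw [← h, sub_self, mul_zero] at this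
    exact (pow_pos hs 2).ne' this
  obtain ⟨t₀, hst₀, ht₀⟩ : ∃ t₀, s < t₀ ∧ deriv u t₀ = 0 := by
    by_contra! hne
    have hderiv_pos : ∀ t, s ≤ t → 0 < deriv u t := fun t hst => by
      by_contra! h
      obtain ⟨r, hr, hr0⟩ := intermediate_value_Icc' hst hu'.continuous.continuousOn
        (⟨h, hs.le⟩ : (0 : ℝ) ∈ Icc _ _)
      rcases hr.1.eq_or_lt with rfl | hsr
      · exact hs.ne' hr0
      · exact hne r hsr hr0
    have humono : MonotoneOn u (Ici s) := by
      refine monotoneOn_of_deriv_nonneg (convex_Ici s) hu.continuous.continuousOn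
        hu.differentiableOn fun x hx => ?_
      rw [interior_Ici] at hx
      exact (hderiv_pos x (le_of_lt hx)).le
    obtain ⟨L, hL⟩ : ∃ L, Tendsto u atTop (𝓝 L) := by
      have hm : Monotone fun t => u (max s t) := fun x y hxy =>
        humono (le_max_left s x) (le_max_left s y) (max_le_max_left s hxy)
      refine ⟨_, (tendsto_atTop_ciSup hm ⟨b, ?_⟩).congr' ?_⟩
      · rintro _ ⟨t, rfl⟩
        exact (hupper _).le
      · filter_upwards [eventually_ge_atTop s] with t ht
        rw [max_eq_right ht]
    have hLs : u s ≤ L := ge_of_tendsto hL <| by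
      filter_upwards [eventually_ge_atTop s] with t ht
      exact humono self_mem_Ici ht ht
    have hL0 : 0 < L := (hpos s).trans_le hLs
    have hVL : Tendsto (fun t => 2 * (V (u t) - V (u 0))) atTop (𝓝 (2 * (V L - V (u 0)))) :=
      (((hV L hL0).continuousAt.tendsto.comp hL).sub_const _).const_mul 2
    have hu'L : Tendsto (deriv u) atTop (𝓝 √(2 * (V L - V (u 0)))) := by
      refine hVL.sqrt.congr' ?_
      filter_upwards [eventually_ge_atTop s] with t ht
      rw [← henergy t, Real.sqrt_sq (hderiv_pos t ht).le]
    have hu''L : Tendsto (deriv (deriv u)) atTop (𝓝 (V' L)) := by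
      refine ((hV'.continuousAt (Ioi_mem_nhds hL0)).tendsto.comp hL).congr fun t => ?_
      simp [hode]
    have hV'L : V' L = 0 := tendsto_deriv_atTop_eq_zero hu' hu'L hu''L
    have hVL0 : V L = V (u 0) := by
      have hle : V (u 0) ≤ V L := by
        have : 0 ≤ 2 * (V L - V (u 0)) := ge_of_tendsto' hVL fun t => by linarith [hlevel t]
        linarith
      have := Real.sqrt_eq_zero'.1 (tendsto_deriv_atTop_eq_zero hu hL hu'L)
      linarith
    exact (hdec L (hcross L (hus.trans_le hLs) hVL0)).ne hV'L
  obtain ⟨t₁, ht₁, hmax⟩ := isCompact_Icc.exists_isMaxOn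
    (nonempty_Icc.2 (hs0.trans hst₀).le) hu.continuous.continuousOn
  have hut₁ : u 0 < u t₁ := hus.trans_le (hmax ⟨hs0.le, hst₀.le⟩)
  have hdt₁ : deriv u t₁ = 0 := by
    rcases ht₁.1.eq_or_lt with rfl | h₁
    · exact h0
    rcases ht₁.2.eq_or_lt with rfl | h₂
    · exact ht₀
    · exact (hmax.isLocalMax (Icc_mem_nhds h₁ h₂)).deriv_eq_zero
  have hVt₁ : V (u t₁) = V (u 0) := by
    have := henergy t₁
    rw [hdt₁] at this
    linarith
  have hat₁ : a < u t₁ := hcross _ hut₁ hVt₁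
  refine ⟨u t₁, ⟨mem_range_self t₁, ?_⟩, hut₁, hupper t₁, hVt₁⟩
  rintro _ ⟨t, rfl⟩
  by_contra! h
  exact (hVt₁ ▸ hlevel t).not_gt (hanti hat₁.le (hat₁.trans h).le h)


/-- The supremum `ε̄` of a Delaunay solution with necksize `ε` is attained, lies in `(ε, 1)`,
and satisfies the energy relation `ε̄² − ε̄^(2n/(n−2)) = ε² − ε^(2n/(n−2))`. -/
theorem delaunay_max_value (n : ℕ) (hn : 3 ≤ n) (ε : ℝ) (hε0 : 0 < ε)
    (hεcyl : ε < (((n : ℝ) - 2) / (n : ℝ)) ^ (((n : ℝ) - 2) / 4))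
    (u : ℝ → ℝ) (hu_pos : ∀ t, 0 < u t)
    (hu1 : Differentiable ℝ u) (hu2 : Differentiable ℝ (deriv u))
    (hode : ∀ t : ℝ,
      deriv (deriv u) t - ((n : ℝ) - 2) ^ 2 / 4 * u t
        + (n : ℝ) * ((n : ℝ) - 2) / 4 * (u t) ^ (((n : ℝ) + 2) / ((n : ℝ) - 2)) = 0)
    (h0 : u 0 = ε) (h0' : deriv u 0 = 0) :
    ∃ εmax : ℝ, IsGreatest (Set.range u) εmax ∧ ε < εmax ∧ εmax < 1 ∧
      εmax ^ 2 - εmax ^ (2 * (n : ℝ) / ((n : ℝ) - 2))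
        = ε ^ 2 - ε ^ (2 * (n : ℝ) / ((n : ℝ) - 2)) := by
  have hn' : (3 : ℝ) ≤ n := by exact_mod_cast hn
  have hn0 : (0 : ℝ) < n := by linarith
  have hn2 : (0 : ℝ) < (n : ℝ) - 2 := by linarith
  set p : ℝ := 2 * (n : ℝ) / ((n : ℝ) - 2) with hp
  set q : ℝ := 4 / ((n : ℝ) - 2) with hq
  set a : ℝ := (((n : ℝ) - 2) / (n : ℝ)) ^ (((n : ℝ) - 2) / 4) with ha
  have hq0 : 0 < q := by positivity
  have hpq : p - 1 = 1 + q := by rw [hp, hq]; field_simp; ring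
  have hexp : ((n : ℝ) + 2) / ((n : ℝ) - 2) = 1 + q := by rw [hq]; field_simp; ring
  have hbase : 0 < ((n : ℝ) - 2) / n := by positivity
  have ha0 : 0 < a := Real.rpow_pos_of_pos hbase _
  have ha1 : a < 1 := Real.rpow_lt_one hbase.le
    ((div_lt_one hn0).2 (by linarith)) (by positivity)
  have haq : a ^ q = ((n : ℝ) - 2) / n := by
    rw [ha, ← Real.rpow_mul hbase.le, hq, div_mul_div_cancel₀ four_ne_zero, div_self hn2.ne',
      Real.rpow_one]
  let V : ℝ → ℝ := fun x => ((n : ℝ) - 2) ^ 2 / 8 * (x ^ 2 - x ^ p)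
  let V' : ℝ → ℝ := fun x => n * ((n : ℝ) - 2) / 4 * x * (((n : ℝ) - 2) / n - x ^ q)
  have hV : ∀ x, 0 < x → HasDerivAt V (V' x) x := fun x hx => by
    refine (((hasDerivAt_pow 2 x).sub
      (Real.hasDerivAt_rpow_const (p := p) (Or.inl hx.ne'))).const_mul _).congr_deriv ?_
    simp only [V']
    rw [hpq, Real.rpow_add hx, Real.rpow_one, hp]
    field_simp
    ring
  have hcoef : ∀ x : ℝ, 0 < x → 0 < n * ((n : ℝ) - 2) / 4 * x := fun x hx => by positivity
  have hode' : ∀ t, deriv (deriv u) t = V' (u t) := fun t => by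
    have h := hode t
    rw [hexp, Real.rpow_add (hu_pos t), Real.rpow_one] at h
    have h' : V' (u t) = ((n : ℝ) - 2) ^ 2 / 4 * u t
        - (n : ℝ) * ((n : ℝ) - 2) / 4 * (u t * u t ^ q) := by
      simp only [V']
      field_simp
    linarith
  have hV1 : V 1 < V (u 0) := by
    have hε1 : ε < 1 := hεcyl.trans ha1
    have hp2 : 2 < p := by rw [hp, lt_div_iff₀ hn2]; linarith
    have hlt : ε ^ p < ε ^ 2 := by
      simpa using Real.rpow_lt_rpow_of_exponent_gt hε0 hε1 hp2
    simp only [V, h0, Real.one_rpow, one_pow, sub_self, mul_zero]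
    have : 0 < ε ^ 2 - ε ^ p := sub_pos.2 hlt
    positivity
  obtain ⟨M, hM, h0M, hM1, hVM⟩ := exists_isGreatest_range_of_deriv_deriv_eq
    (V := V) (V' := V') (a := a) (b := 1) hV
    (by
      have : Continuous fun x : ℝ => x ^ q := Real.continuous_rpow_const hq0.le
      fun_prop)
    (fun x hx hxa => mul_pos (hcoef x hx) <| by
      rw [← haq]
      exact sub_pos.2 (Real.rpow_lt_rpow hx.le hxa hq0))
    (fun x hxa => mul_neg_of_pos_of_neg (hcoef x (ha0.trans hxa)) <| by
      rw [← haq]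
      exact sub_neg.2 (Real.rpow_lt_rpow ha0.le hxa hq0))
    hu_pos hu1 hu2 hode' h0' (h0 ▸ hεcyl) ha1 hV1
  rw [h0] at h0M hVM
  exact ⟨M, hM, h0M, hM1, mul_left_cancel₀ (by positivity) hVM⟩
end

section
/- Let p, q : ℝ → ℝ be functions, P ≥ 0, δ > 0 and γ > 0 constants with |p(t)| ≤ P and q(t) ≤ −δ for all t, and suppose γ² + Pγ − δ < 0. Let v : ℝ → ℝ be a twice differentiable solution of v'' + p·v' + q·v = 0 on ℝ such that v(t)/cosh(γt) → 0 as |t| → ∞. Then v is identically zero. -/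
/-- Second-derivative test: the second derivative is nonpositive at a local maximum. -/
theorem IsLocalMax.deriv_deriv_nonpos {f : ℝ → ℝ} {a : ℝ} (h : IsLocalMax f a)
    (hc : ContinuousAt f a) : deriv (deriv f) a ≤ 0 := by
  by_contra! hpos
  have hmin : IsLocalMin f a := isLocalMin_of_deriv_deriv_pos hpos h.deriv_eq_zero hc
  have hconst : f =ᶠ[nhds a] fun _ => f a := by
    filter_upwards [h, hmin] with x hx hx'
    exact le_antisymm hx hx'
  have hzero : deriv (deriv f) a = 0 := by
    rw [hconst.deriv.deriv_eq]
    simp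
  exact hpos.ne' hzero

theorem Real.abs_sinh_le_cosh (x : ℝ) : |Real.sinh x| ≤ Real.cosh x :=
  abs_le_of_sq_le_sq (by linarith [Real.cosh_sq x]) (Real.cosh_pos x).le

/-- Comparison with `cosh (γ t)`: a solution that is `o(cosh (γ t))` is nowhere positive. -/
theorem nonpos_of_tendsto_div_cosh {p q v : ℝ → ℝ} {P δ γ : ℝ} (hγ : 0 < γ)
    (hp : ∀ t : ℝ, |p t| ≤ P) (hq : ∀ t : ℝ, q t ≤ -δ)
    (hroot : γ ^ 2 + P * γ - δ < 0)
    (hv1 : Differentiable ℝ v) (hv2 : Differentiable ℝ (deriv v))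
    (hode : ∀ t : ℝ, deriv (deriv v) t + p t * deriv v t + q t * v t = 0)
    (hdecay : Filter.Tendsto (fun t => v t / Real.cosh (γ * t))
      (Filter.cocompact ℝ) (nhds 0)) (t : ℝ) : v t ≤ 0 := by
  by_contra! ht
  have hcont : Continuous fun t => v t / Real.cosh (γ * t) :=
    hv1.continuous.div (by fun_prop) fun t => (Real.cosh_pos _).ne'
  obtain ⟨s, hs⟩ := hcont.exists_forall_ge' t
    ((hdecay.eventually_lt_const (div_pos ht (Real.cosh_pos _))).mono fun _ => le_of_lt)
  obtain ⟨m, hm⟩ : ∃ m, m = v s / Real.cosh (γ * s) := ⟨_, rfl⟩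
  rw [← hm] at hs
  have hmpos : 0 < m := (div_pos ht (Real.cosh_pos _)).trans_le (hs t)
  have hvs : v s = m * Real.cosh (γ * s) := by
    rw [hm, div_mul_cancel₀ _ (Real.cosh_pos _).ne']
  have hlin : ∀ x : ℝ, HasDerivAt (fun x => γ * x) γ x := fun x => by
    simpa using (hasDerivAt_id x).const_mul γ
  have hz1 : ∀ x, HasDerivAt (fun x => v x - m * Real.cosh (γ * x))
      (deriv v x - m * (Real.sinh (γ * x) * γ)) x := fun x =>
    (hv1 x).hasDerivAt.sub ((hlin x).cosh.const_mul m)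
  have hz2 : HasDerivAt (fun x => deriv v x - m * (Real.sinh (γ * x) * γ))
      (deriv (deriv v) s - m * (Real.cosh (γ * s) * γ * γ)) s :=
    (hv2 s).hasDerivAt.sub (((hlin s).sinh.mul_const γ).const_mul m)
  have hmax : IsLocalMax (fun x => v x - m * Real.cosh (γ * x)) s := by
    refine Filter.Eventually.of_forall fun x => ?_
    have := (div_le_iff₀ (Real.cosh_pos (γ * x))).mp (hs x)
    simp only [hvs]
    linarith
  have h1 := hmax.hasDerivAt_eq_zero (hz1 s)
  have h2 := hmax.deriv_deriv_nonpos (hz1 s).continuousAt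
  rw [funext fun x => (hz1 x).deriv, hz2.deriv] at h2
  have hps : p s * Real.sinh (γ * s) ≤ P * Real.cosh (γ * s) := by
    refine (le_abs_self _).trans ?_
    rw [abs_mul]
    exact mul_le_mul (hp s) (Real.abs_sinh_le_cosh _) (abs_nonneg _)
      ((abs_nonneg _).trans (hp s))
  have hode' := hode s
  rw [hvs, show deriv v s = m * (Real.sinh (γ * s) * γ) by linarith] at hode'
  have hmc : 0 < m * Real.cosh (γ * s) := mul_pos hmpos (Real.cosh_pos _)
  have e1 := mul_le_mul_of_nonneg_left hps (mul_pos hmpos hγ).le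
  have e2 := mul_le_mul_of_nonneg_right (hq s) hmc.le
  have e3 := mul_neg_of_pos_of_neg hmc hroot
  linarith

/-- Maximum-principle lemma: a solution of `v'' + p v' + q v = 0` with `q ≤ -δ < 0`, `|p| ≤ P`
and `γ² + Pγ - δ < 0`, growing slower than `cosh(γt)` in both directions, vanishes identically. -/
theorem subexponential_solution_vanishes (p q : ℝ → ℝ) (P δ γ : ℝ)
    (hP : 0 ≤ P) (hδ : 0 < δ) (hγ : 0 < γ)
    (hp : ∀ t : ℝ, |p t| ≤ P) (hq : ∀ t : ℝ, q t ≤ -δ)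
    (hroot : γ ^ 2 + P * γ - δ < 0)
    (v : ℝ → ℝ) (hv1 : Differentiable ℝ v) (hv2 : Differentiable ℝ (deriv v))
    (hode : ∀ t : ℝ, deriv (deriv v) t + p t * deriv v t + q t * v t = 0)
    (hdecay : Filter.Tendsto (fun t => v t / Real.cosh (γ * t))
      (Filter.cocompact ℝ) (nhds 0)) :
    ∀ t : ℝ, v t = 0 := by
  intro t
  refine le_antisymm (nonpos_of_tendsto_div_cosh hγ hp hq hroot hv1 hv2 hode hdecay t) ?_
  have hd : deriv (fun t => -v t) = fun t => -deriv v t := funext fun t => deriv.fun_neg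
  have hneg := nonpos_of_tendsto_div_cosh (v := fun t => -v t) hγ hp hq hroot hv1.fun_neg
    (by rw [hd]; exact hv2.fun_neg)
    (fun t => by
      rw [hd, deriv.fun_neg]
      linarith [hode t])
    (by simpa [neg_div] using hdecay.neg) t
  linarith
end
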